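/- Honest classical game value of the oracularized 3XOR game admits an integrality gap: there exist constants c > 0, δ > 0 and n₀ such that for all n ≥ n₀ there exist a 3XOR instance Ψ_n with n variables and real numbers α, β ≥ 0 with α + β = 1 and α ≥ δ·2, such that the polynomial f(x) = α·Val_{Ψ_n}(x) + β (the winning probability of the honest classical strategy given by assignment x in the oracularized game, where Val_{Ψ_n}(x) = (1/m)·Σ_{clauses (i,j,k,a)} (1 + a·x_i·x_j·x_k)/2 is the fraction of clauses of Ψ_n satisfied by x) satisfies: (i) f(x) ≤ 1 − δ for every x ∈ {−1,1}ⁿ; (ii) there exists a degree-⌈c·n⌉ pseudo-expectation E over ℝ[x₁,…,x_n] satisfying the Boolean constraints with E[f] = 1. -/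

import Mathlib

open MvPolynomial
open scoped Classical

/-- A Boolean (±1) assignment. -/
def IsPM {ι : Type*} (x : ι → ℝ) : Prop := ∀ i, x i = 1 ∨ x i = -1

/-- A 3XOR clause: a triple of variable indices together with a sign
(`true` codes `+1`, `false` codes `-1`). -/
structure XorClause (n : ℕ) where
  i : Fin n
  j : Fin n
  k : Fin n
  a : Bool

/-- The 0/1-valued predicate polynomial of a 3XOR clause: `(1 + a·x_i·x_j·x_k)/2`. -/
noncomputable def xorClausePoly {n : ℕ} (c : XorClause n) : MvPolynomial (Fin n) ℝ :=
  C (1 / 2) * (1 + C (if c.a then 1 else -1) * (X c.i * X c.j * X c.k))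

/-- The fraction of clauses of `Ψ` satisfied, as a polynomial:
`Val_Ψ(x) = (1/m)·Σ_{(i,j,k,a)} (1 + a·x_i·x_j·x_k)/2`. -/
noncomputable def valPoly {n : ℕ} (Ψ : List (XorClause n)) : MvPolynomial (Fin n) ℝ :=
  C (1 / (Ψ.length : ℝ)) * (Ψ.map xorClausePoly).sum

section Parity

theorem ZMod.eq_zero_or_eq_one : ∀ z : ZMod 2, z = 0 ∨ z = 1 := by decide

variable {ι κ : Type*} [Fintype ι] [Fintype κ]

/-- The characteristic vector over `𝔽₂` of the sum of the rows of a 3XOR system selected by `y`,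
where row `r` involves the variables `g r 0`, `g r 1`, `g r 2`. -/
noncomputable def parityVec (g : κ → Fin 3 → ι) : (κ → ZMod 2) →+ (ι → ZMod 2) where
  toFun y i := ∑ p : κ × Fin 3, if g p.1 p.2 = i then y p.1 else 0
  map_zero' := by ext; simp
  map_add' y z := by
    ext i
    simp only [Pi.add_apply, ← Finset.sum_add_distrib]
    exact Finset.sum_congr rfl fun p _ => by split_ifs <;> simp

theorem hammingNorm_add_le_add {x y : ι → ZMod 2} :
    hammingNorm (x + y) ≤ hammingNorm x + hammingNorm y := by
  have h := hammingDist_triangle (-x) 0 y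
  rw [hammingDist_eq_hammingNorm, hammingDist_eq_hammingNorm, hammingDist_eq_hammingNorm] at h
  simpa using h

/-- If the rows in the support of `y` involve many variables, then many of them occur an odd
number of times. -/
theorem lt_hammingNorm_parityVec (g : κ → Fin 3 → ι) (y : κ → ZMod 2)
    (h : 7 * hammingNorm y <
      4 * ((Finset.univ.filter (y · ≠ 0)).biUnion fun r => Finset.univ.image (g r)).card) :
    hammingNorm y < 2 * hammingNorm (parityVec g y) := by
  set S : Finset κ := Finset.univ.filter (y · ≠ 0) with hS
  set N : Finset ι := S.biUnion fun r => Finset.univ.image (g r) with hN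
  let slots : ι → Finset (κ × Fin 3) := fun i => (S ×ˢ Finset.univ).filter fun p => g p.1 p.2 = i
  have hsum : 3 * hammingNorm y = ∑ i ∈ N, (slots i).card := by
    rw [← Finset.card_eq_sum_card_fiberwise (f := fun p : κ × Fin 3 => g p.1 p.2)]
    · simp [hammingNorm, hS, mul_comm]
    · intro p hp
      simp only [Finset.coe_product, Set.mem_prod, Finset.mem_coe] at hp
      simp only [hN, Finset.coe_biUnion, Set.mem_iUnion, Finset.mem_coe]
      exact ⟨p.1, hp.1, Finset.mem_image_of_mem _ (Finset.mem_univ _)⟩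
  have hval (i : ι) : parityVec g y i = ((slots i).card : ZMod 2) := by
    rw [Finset.card_filter, Finset.sum_product, Nat.cast_sum, hS, Finset.sum_filter]
    simp only [parityVec, AddMonoidHom.coe_mk, ZeroHom.coe_mk, Fintype.sum_prod_type]
    refine Finset.sum_congr rfl fun r _ => ?_
    rcases (y r).eq_zero_or_eq_one with hr | hr <;> simp [hr]
  have htwo (i : ι) (hi : i ∈ N) :
      2 ≤ (slots i).card + if parityVec g y i ≠ 0 then 1 else 0 := by
    have hpos : 1 ≤ (slots i).card := by
      obtain ⟨r, hr, hi⟩ := Finset.mem_biUnion.1 hi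
      obtain ⟨l, -, hl⟩ := Finset.mem_image.1 hi
      exact Finset.card_pos.2 ⟨(r, l), by simp [slots, hr, hl]⟩
    rw [hval]
    split_ifs with h0
    · omega
    · have : (slots i).card ≠ 1 := fun h1 => h0 (by rw [h1]; decide)
      omega
  have hle := Finset.sum_le_sum htwo
  rw [Finset.sum_add_distrib, ← hsum, Finset.sum_const, smul_eq_mul, ← Finset.card_filter] at hle
  have hsub : (N.filter fun i => parityVec g y i ≠ 0).card ≤ hammingNorm (parityVec g y) :=
    Finset.card_le_card (Finset.filter_subset_filter _ (Finset.subset_univ _))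
  omega

theorem sum_half_pow_hammingDist (v : κ → ZMod 2) :
    ∑ b : κ → ZMod 2, (1 / 2 : ℝ) ^ hammingDist b v = (3 / 2) ^ Fintype.card κ := by
  have h1 (b : κ → ZMod 2) :
      (1 / 2 : ℝ) ^ hammingDist b v = ∏ i, if b i ≠ v i then 1 / 2 else 1 := by
    rw [hammingDist, Finset.prod_ite]
    simp
  simp only [h1]
  rw [← Fintype.prod_sum fun i z => if z ≠ v i then (1 / 2 : ℝ) else 1]
  have h2 (w : ZMod 2) : ∑ z, (if z ≠ w then (1 / 2 : ℝ) else 1) = 3 / 2 := by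
    have hu : (Finset.univ : Finset (ZMod 2)) = {0, 1} := rfl
    rcases w.eq_zero_or_eq_one with rfl | rfl <;> rw [hu, Finset.sum_pair (by decide)] <;> norm_num
  simp only [h2, Finset.prod_const, Finset.card_univ]

/-- A family of few vectors in a cube leaves some vector at linear distance from all of them. -/
theorem exists_forall_lt_hammingDist {n : ℕ} (hn : 0 < n)
    (hι : Fintype.card ι = n) (hκ : Fintype.card κ = 8 * n)
    (v : (ι → ZMod 2) → κ → ZMod 2) : ∃ b : κ → ZMod 2, ∀ u, n < hammingDist b (v u) := by
  by_contra! hcon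
  have hlow (b : κ → ZMod 2) : (1 / 2 : ℝ) ^ n ≤ ∑ u, (1 / 2 : ℝ) ^ hammingDist b (v u) := by
    obtain ⟨u, hu⟩ := hcon b
    exact (pow_le_pow_of_le_one (by norm_num) (by norm_num) hu).trans
      (Finset.single_le_sum (f := fun u => (1 / 2 : ℝ) ^ hammingDist b (v u))
        (fun _ _ => by positivity) (Finset.mem_univ u))
  have h := Finset.sum_le_sum fun b (_ : b ∈ Finset.univ) => hlow b
  rw [Finset.sum_comm] at h
  simp only [sum_half_pow_hammingDist, Finset.sum_const, Finset.card_univ, Fintype.card_fun,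
    ZMod.card, hι, hκ, nsmul_eq_mul, Nat.cast_pow, Nat.cast_ofNat, pow_mul, ← mul_pow] at h
  exact absurd h (not_le.2 (pow_lt_pow_left₀ (by norm_num) (by norm_num) hn.ne'))

end Parity

section Expansion

theorem choose_mul_pow_le (n k : ℕ) :
    (n.choose k : ℝ) * k ^ k ≤ Real.exp 1 ^ k * n ^ k := by
  have h1 : (n.choose k : ℝ) ≤ n ^ k / k.factorial := Nat.choose_le_pow_div k n
  have h2 := Real.pow_div_factorial_le_exp k k.cast_nonneg k
  rw [← Real.exp_one_pow] at h2
  calc (n.choose k : ℝ) * k ^ k ≤ n ^ k / k.factorial * k ^ k := by gcongr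
    _ = (k ^ k / k.factorial) * n ^ k := by ring
    _ ≤ _ := by gcongr

/-- The inverse of the expansion threshold. -/
abbrev expansionRate : ℕ := 2 ^ 25 * 3 ^ 11

theorem choose_mul_choose_mul_pow_le {n k t : ℕ} (hk : 0 < k) (ht : 4 * t ≤ 7 * k)
    (hkn : k * expansionRate ≤ n) :
    ((8 * n).choose k : ℝ) * n.choose t * ((t : ℝ) / n) ^ (3 * k) ≤ (1 / 4) ^ k := by
  have hn : 0 < n := lt_of_lt_of_le (by positivity) hkn
  have hk' : (0 : ℝ) < k := by exact_mod_cast hk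
  have hn' : (0 : ℝ) < n := by exact_mod_cast hn
  have he : Real.exp 1 ≤ 3 := Real.exp_one_lt_three.le
  set z : ℝ := k / n with hz
  have hz0 : 0 < z := by positivity
  have hzle : z * expansionRate ≤ 1 := by
    rw [hz, div_mul_eq_mul_div, div_le_one hn']
    exact_mod_cast hkn
  have htz : (t : ℝ) / n ≤ 2 * z := by
    rw [hz, ← mul_div_assoc]
    gcongr
    have : t ≤ 2 * k := by omega
    exact_mod_cast this
  have hA : ((8 * n).choose k : ℝ) ≤ (24 / z) ^ k := by
    have h := choose_mul_pow_le (8 * n) k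
    rw [← le_div_iff₀ (by positivity), ← mul_pow, ← div_pow] at h
    refine h.trans (pow_le_pow_left₀ (by positivity) ?_ _)
    rw [hz, div_div_eq_mul_div, Nat.cast_mul]
    push_cast
    rw [← mul_assoc]
    gcongr
    linarith
  have hB : (n.choose t : ℝ) * ((t : ℝ) / n) ^ t ≤ 3 ^ t := by
    have h := choose_mul_pow_le n t
    rw [div_pow, ← mul_div_assoc, div_le_iff₀ (by positivity)]
    exact h.trans (by gcongr)
  have hX : ((8 * n).choose k : ℝ) * n.choose t * ((t : ℝ) / n) ^ (3 * k) ≤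
      (24 / z) ^ k * 3 ^ t * (2 * z) ^ (3 * k - t) := by
    have : 3 * k = t + (3 * k - t) := by omega
    calc ((8 * n).choose k : ℝ) * n.choose t * ((t : ℝ) / n) ^ (3 * k)
        = (8 * n).choose k * (n.choose t * ((t : ℝ) / n) ^ t) * ((t : ℝ) / n) ^ (3 * k - t) := by
          conv_lhs => rw [this, pow_add]
          ring
      _ ≤ _ := by gcongr
  refine hX.trans ((pow_le_pow_iff_left₀ (by positivity) (by positivity) four_ne_zero).1 ?_)
  have h2z : 2 * z ≤ 1 := by
    norm_num [expansionRate] at hzle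
    linarith
  calc ((24 / z) ^ k * 3 ^ t * (2 * z) ^ (3 * k - t)) ^ 4
      = ((24 / z) ^ 4) ^ k * 3 ^ (4 * t) * (2 * z) ^ (4 * (3 * k - t)) := by
        rw [mul_pow, mul_pow, ← pow_mul, ← pow_mul, ← pow_mul, ← pow_mul, mul_comm k, mul_comm t,
          mul_comm (3 * k - t)]
    _ ≤ ((24 / z) ^ 4) ^ k * 3 ^ (7 * k) * (2 * z) ^ (5 * k) := by
        gcongr ?_ * ?_ * ?_
        · exact pow_le_pow_right₀ (by norm_num) ht
        · exact pow_le_pow_of_le_one (by positivity) h2z (by omega)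
    _ = ((24 / z) ^ 4 * 3 ^ 7 * (2 * z) ^ 5) ^ k := by
        rw [pow_mul 3, pow_mul (2 * z), ← mul_pow, ← mul_pow]
    _ ≤ ((1 / 4) ^ 4) ^ k := by
        gcongr
        have : (24 / z) ^ 4 * 3 ^ 7 * (2 * z) ^ 5 = 2 ^ 17 * 3 ^ 11 * z := by
          field_simp
          norm_num
        rw [this]
        norm_num [expansionRate] at hzle ⊢
        linarith
    _ = ((1 / 4) ^ k) ^ 4 := by rw [← pow_mul, ← pow_mul, mul_comm]

theorem card_filter_forall_mem {m n : ℕ} (S : Finset (Fin m)) (T : Finset (Fin n)) :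
    ((Finset.univ.filter fun g : Fin m → Fin 3 → Fin n => ∀ r ∈ S, ∀ l, g r l ∈ T).card : ℝ) =
      (n ^ 3) ^ m * ((T.card : ℝ) / n) ^ (3 * S.card) := by
  have h : (Finset.univ.filter fun g : Fin m → Fin 3 → Fin n => ∀ r ∈ S, ∀ l, g r l ∈ T) =
      Fintype.piFinset fun r => if r ∈ S then Fintype.piFinset fun _ => T else Finset.univ := by
    ext g
    simp only [Finset.mem_filter, Finset.mem_univ, true_and, Fintype.mem_piFinset]
    refine forall_congr' fun r => ?_
    split_ifs with hr <;> simp [hr]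
  rw [h, Fintype.card_piFinset, Nat.cast_prod]
  have hfac (r : Fin m) :
      (((if r ∈ S then Fintype.piFinset fun _ => T else Finset.univ :
        Finset (Fin 3 → Fin n)).card : ℕ) : ℝ) =
      n ^ 3 * if r ∈ S then ((T.card : ℝ) / n) ^ 3 else 1 := by
    split_ifs with hr
    · rcases Nat.eq_zero_or_pos n with rfl | hn
      · simp [Finset.eq_empty_of_isEmpty T]
      · have : (n : ℝ) ≠ 0 := by positivity
        simp only [Fintype.card_piFinset, Finset.prod_const, Finset.card_univ, Fintype.card_fin]
        push_cast
        field_simp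
    · simp
  simp only [hfac]
  rw [Finset.prod_mul_distrib, Finset.prod_ite_mem, Finset.univ_inter]
  simp [pow_mul]

/-- Some 3XOR system with `8 * n` rows has the property that every small set of rows involves more
than `7 / 4` variables per row. -/
theorem exists_expanding {n K : ℕ} (hn : 0 < n) (hK : K * expansionRate ≤ n) :
    ∃ g : Fin (8 * n) → Fin 3 → Fin n, ∀ S : Finset (Fin (8 * n)), S.Nonempty → S.card ≤ K →
      7 * S.card < 4 * (S.biUnion fun r => Finset.univ.image (g r)).card := by
  by_contra! hcon
  let bad (S : Finset (Fin (8 * n))) (T : Finset (Fin n)) :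
      Finset (Fin (8 * n) → Fin 3 → Fin n) :=
    Finset.univ.filter fun g => ∀ r ∈ S, ∀ l, g r l ∈ T
  have hcover : (Finset.univ : Finset (Fin (8 * n) → Fin 3 → Fin n)) ⊆
      (Finset.Ico 1 (K + 1)).biUnion fun k => (Finset.univ.powersetCard k).biUnion fun S =>
        (Finset.univ.powersetCard (7 * k / 4)).biUnion fun T => bad S T := by
    intro g _
    obtain ⟨S, hS, hSK, hle⟩ := hcon g
    have hk := hS.card_pos
    have h7 : 7 * S.card / 4 ≤ Fintype.card (Fin n) := by
      have : S.card * 2 ≤ n := le_trans (Nat.mul_le_mul hSK (by norm_num)) hK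
      rw [Fintype.card_fin]
      omega
    obtain ⟨T, hT, hTc⟩ := Finset.exists_superset_card_eq
      (s := S.biUnion fun r => Finset.univ.image (g r)) (by omega) h7
    simp only [Finset.mem_biUnion, Finset.mem_Ico, Finset.mem_powersetCard_univ]
    refine ⟨S.card, by omega, S, rfl, T, hTc, ?_⟩
    simp only [bad, Finset.mem_filter, Finset.mem_univ, true_and]
    exact fun r hr l => hT (Finset.mem_biUnion.2
      ⟨r, hr, Finset.mem_image_of_mem _ (Finset.mem_univ _)⟩)
  have hcard : ((n : ℝ) ^ 3) ^ (8 * n) ≤ ∑ k ∈ Finset.Ico 1 (K + 1),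
      ∑ S ∈ (Finset.univ : Finset (Fin (8 * n))).powersetCard k,
        ∑ T ∈ (Finset.univ : Finset (Fin n)).powersetCard (7 * k / 4), ((bad S T).card : ℝ) := by
    have h := Finset.card_le_card hcover
    have h' := h.trans (Finset.card_biUnion_le.trans (Finset.sum_le_sum fun k _ =>
      Finset.card_biUnion_le.trans (Finset.sum_le_sum fun S _ => Finset.card_biUnion_le)))
    simp only [Finset.card_univ, Fintype.card_fun, Fintype.card_fin] at h'
    exact_mod_cast h'
  have hterm (k : ℕ) (hk : k ∈ Finset.Ico 1 (K + 1)) :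
      ∑ S ∈ (Finset.univ : Finset (Fin (8 * n))).powersetCard k,
        ∑ T ∈ (Finset.univ : Finset (Fin n)).powersetCard (7 * k / 4), ((bad S T).card : ℝ) ≤
      ((n : ℝ) ^ 3) ^ (8 * n) * (1 / 4) ^ k := by
    rw [Finset.mem_Ico] at hk
    have h : ∀ S ∈ (Finset.univ : Finset (Fin (8 * n))).powersetCard k,
        ∑ T ∈ (Finset.univ : Finset (Fin n)).powersetCard (7 * k / 4), ((bad S T).card : ℝ) =
        n.choose (7 * k / 4) *
          ((n ^ 3) ^ (8 * n) * (((7 * k / 4 : ℕ) : ℝ) / n) ^ (3 * k)) := by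
      intro S hS
      rw [Finset.sum_congr rfl fun T hT => ?_, Finset.sum_const, Finset.card_powersetCard,
        Finset.card_univ, Fintype.card_fin, nsmul_eq_mul]
      rw [card_filter_forall_mem, (Finset.mem_powersetCard.1 hS).2,
        (Finset.mem_powersetCard.1 hT).2]
    rw [Finset.sum_congr rfl h, Finset.sum_const, Finset.card_powersetCard, Finset.card_univ,
      Fintype.card_fin, nsmul_eq_mul]
    have hb := choose_mul_choose_mul_pow_le (n := n) (k := k) (t := 7 * k / 4) hk.1 (by omega)
      (le_trans (Nat.mul_le_mul_right _ (by omega)) hK)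
    calc _ = ((n : ℝ) ^ 3) ^ (8 * n) * (((8 * n).choose k : ℝ) * n.choose (7 * k / 4) *
          (((7 * k / 4 : ℕ) : ℝ) / n) ^ (3 * k)) := by ring
      _ ≤ _ := by gcongr
  have hfin := hcard.trans (Finset.sum_le_sum hterm)
  rw [← Finset.mul_sum, geom_sum_Ico (by norm_num) (by omega)] at hfin
  have hpos : (0 : ℝ) < ((n : ℝ) ^ 3) ^ (8 * n) := by positivity
  have hK0 : (0 : ℝ) < (1 / 4) ^ (K + 1) := by positivity
  have hlt : ((1 / 4 : ℝ) ^ (K + 1) - (1 / 4) ^ 1) / (1 / 4 - 1) < 1 := by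
    rw [div_lt_iff_of_neg (by norm_num)]
    linarith
  exact absurd hfin (not_le.2 (mul_lt_of_lt_one_right hpos hlt))

end Expansion

section PseudoExpectation

/-- The nontrivial character of `ZMod 2` with values `±1`. -/
noncomputable def signChar (z : ZMod 2) : ℝ := if z = 0 then 1 else -1

@[simp]
theorem signChar_zero : signChar 0 = 1 := if_pos rfl

@[simp]
theorem signChar_one : signChar 1 = -1 := if_neg one_ne_zero

theorem signChar_add (z w : ZMod 2) : signChar (z + w) = signChar z * signChar w := by
  rcases z.eq_zero_or_eq_one with rfl | rfl <;> rcases w.eq_zero_or_eq_one with rfl | rfl <;>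
    simp [show (1 + 1 : ZMod 2) = 0 from rfl]

theorem signChar_mul_self (z : ZMod 2) : signChar z * signChar z = 1 := by
  rw [← signChar_add, CharTwo.add_self_eq_zero, signChar_zero]

theorem signChar_ne_zero (z : ZMod 2) : signChar z ≠ 0 :=
  left_ne_zero_of_mul_eq_one (signChar_mul_self z)

theorem half_one_add_signChar_mul (z w : ZMod 2) :
    1 / 2 * (1 + signChar z * signChar w) = 1 - if z ≠ w then 1 else 0 := by
  rcases z.eq_zero_or_eq_one with rfl | rfl <;> rcases w.eq_zero_or_eq_one with rfl | rfl <;>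
    norm_num

/-- A symmetric kernel that is multiplicative along its own support is positive semidefinite. -/
theorem sum_mul_kernel_nonneg {σ : Type*} (P : Finset σ) (M : σ → σ → ℝ) (c : σ → ℝ)
    (hsymm : ∀ μ ν, M μ ν = M ν μ) (hone : ∀ μ, M μ μ = 1)
    (hmul : ∀ μ ∈ P, ∀ ν ∈ P, ∀ ρ ∈ P, M μ ν ≠ 0 → M μ ρ = M μ ν * M ν ρ) :
    0 ≤ ∑ μ ∈ P, ∑ ν ∈ P, c μ * c ν * M μ ν := by
  let N (ρ : σ) : ℝ := ∑ μ ∈ P, M ρ μ ^ 2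
  have hNpos (μ : σ) (hμ : μ ∈ P) : 0 < N μ := by
    have := Finset.single_le_sum (f := fun ν => M μ ν ^ 2) (fun _ _ => sq_nonneg _) hμ
    simp only [hone] at this
    exact lt_of_lt_of_le (by norm_num) this
  have hsq (μ : σ) (hμ : μ ∈ P) (ρ : σ) (hρ : ρ ∈ P) (h : M μ ρ ≠ 0) : M μ ρ ^ 2 = 1 := by
    rw [← hone μ, hmul μ hμ ρ hρ μ hμ h, hsymm ρ μ, sq]
  have hN (μ : σ) (hμ : μ ∈ P) (ρ : σ) (hρ : ρ ∈ P) (h : M μ ρ ≠ 0) : N μ = N ρ := by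
    refine Finset.sum_congr rfl fun ν hν => ?_
    rw [hmul μ hμ ρ hρ ν hν h, mul_pow, hsq μ hμ ρ hρ h, one_mul]
  have hM (μ : σ) (hμ : μ ∈ P) (ν : σ) (hν : ν ∈ P) :
      M μ ν = ∑ ρ ∈ P, (N ρ)⁻¹ * (M ρ μ * M ρ ν) := by
    have hterm (ρ : σ) (hρ : ρ ∈ P) :
        (N ρ)⁻¹ * (M ρ μ * M ρ ν) = (N μ)⁻¹ * M μ ν * M μ ρ ^ 2 := by
      by_cases h : M μ ρ = 0
      · rw [hsymm ρ μ, h]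
        ring
      · rw [hmul ρ hρ μ hμ ν hν (by rwa [hsymm]), hN μ hμ ρ hρ h, hsymm ρ μ]
        ring
    rw [Finset.sum_congr rfl hterm, ← Finset.mul_sum, mul_right_comm,
      inv_mul_cancel₀ (hNpos μ hμ).ne', one_mul]
  have hsum : ∑ μ ∈ P, ∑ ν ∈ P, c μ * c ν * M μ ν =
      ∑ ρ ∈ P, (N ρ)⁻¹ * (∑ μ ∈ P, c μ * M ρ μ) ^ 2 := by
    have h1 : ∀ μ ∈ P, ∑ ν ∈ P, c μ * c ν * M μ ν =
        ∑ ρ ∈ P, ∑ ν ∈ P, (N ρ)⁻¹ * (c μ * M ρ μ * (c ν * M ρ ν)) := by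
      intro μ hμ
      rw [Finset.sum_comm]
      refine Finset.sum_congr rfl fun ν hν => ?_
      rw [hM μ hμ ν hν, Finset.mul_sum]
      exact Finset.sum_congr rfl fun ρ _ => by ring
    rw [Finset.sum_congr rfl h1, Finset.sum_comm]
    refine Finset.sum_congr rfl fun ρ _ => ?_
    rw [sq, Finset.sum_mul_sum]
    simp only [Finset.mul_sum]
  rw [hsum]
  exact Finset.sum_nonneg fun ρ hρ => mul_nonneg (inv_nonneg.2 (hNpos ρ hρ).le) (sq_nonneg _)

/-- The exponents of a monomial modulo `2`. -/
def exponentParity {ι : Type*} : (ι →₀ ℕ) →+ (ι → ZMod 2) where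
  toFun μ i := μ i
  map_zero' := by ext; simp
  map_add' μ ν := by ext; simp

theorem exponentParity_apply {ι : Type*} (μ : ι →₀ ℕ) (i : ι) : exponentParity μ i = μ i := rfl

variable {ι κ : Type*} [Fintype ι] [Fintype κ]

/-- The value forced on the parity `T` by a combination of at most `s` equations of the system
`g`, `b`, and `0` if there is no such combination. -/
noncomputable def parityMoment (g : κ → Fin 3 → ι) (b : κ → ZMod 2) (s : ℕ)
    (T : ι → ZMod 2) : ℝ :=
  if h : ∃ y, hammingNorm y ≤ s ∧ parityVec g y = T then signChar (b ⬝ᵥ h.choose) else 0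

/-- Every nontrivial combination of at most `K` rows has large Hamming norm. -/
def IsParityExpanding (g : κ → Fin 3 → ι) (K : ℕ) : Prop :=
  ∀ y : κ → ZMod 2, y ≠ 0 → hammingNorm y ≤ K → hammingNorm y < 2 * hammingNorm (parityVec g y)

variable {g : κ → Fin 3 → ι} {b : κ → ZMod 2} {s d : ℕ}

theorem parityMoment_parityVec (hg : IsParityExpanding g (2 * s)) {y : κ → ZMod 2}
    (hy : hammingNorm y ≤ s) : parityMoment g b s (parityVec g y) = signChar (b ⬝ᵥ y) := by
  have h : ∃ z, hammingNorm z ≤ s ∧ parityVec g z = parityVec g y := ⟨y, hy, rfl⟩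
  rw [parityMoment, dif_pos h]
  obtain ⟨hz, hzy⟩ := h.choose_spec
  congr 2
  by_contra hne
  have hlt := hg (h.choose + y) (by rwa [Ne, ← ZModModule.sub_eq_add, sub_eq_zero])
    (hammingNorm_add_le_add.trans (by omega))
  rw [map_add, hzy, ZModModule.add_self, hammingNorm_zero] at hlt
  omega

theorem exists_of_parityMoment_ne_zero {T : ι → ZMod 2} (h : parityMoment g b s T ≠ 0) :
    ∃ y, hammingNorm y ≤ s ∧ parityVec g y = T := by
  by_contra hcon
  exact h (dif_neg hcon)

theorem hammingNorm_le_of_parityVec (hg : IsParityExpanding g (2 * (2 * d)))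
    {y : κ → ZMod 2} (hy : hammingNorm y ≤ 2 * (2 * d)) (hd : hammingNorm (parityVec g y) ≤ d) :
    hammingNorm y ≤ 2 * d := by
  rcases eq_or_ne y 0 with rfl | h0
  · simp
  · have := hg y h0 hy
    omega

theorem parityMoment_add (hg : IsParityExpanding g (2 * (2 * d))) {U V : ι → ZMod 2}
    (hU : parityMoment g b (2 * d) U ≠ 0) (hV : hammingNorm V ≤ d)
    (hUV : hammingNorm (U + V) ≤ d) :
    parityMoment g b (2 * d) (U + V) = parityMoment g b (2 * d) U * parityMoment g b (2 * d) V := by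
  obtain ⟨y, hy, rfl⟩ := exists_of_parityMoment_ne_zero hU
  by_cases h : parityMoment g b (2 * d) V = 0
  · rw [h, mul_zero]
    by_contra hne
    obtain ⟨z, hz, hzV⟩ := exists_of_parityMoment_ne_zero hne
    have hyz : parityVec g (y + z) = V := by
      rw [map_add, hzV, ← add_assoc, ZModModule.add_self, zero_add]
    have hle := hammingNorm_le_of_parityVec hg (hammingNorm_add_le_add.trans (by omega))
      (hyz ▸ hV)
    rw [← hyz, parityMoment_parityVec hg hle] at h
    exact signChar_ne_zero _ h
  · obtain ⟨z, hz, rfl⟩ := exists_of_parityMoment_ne_zero h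
    rw [← map_add] at hUV ⊢
    have hle := hammingNorm_le_of_parityVec hg (hammingNorm_add_le_add.trans (by omega)) hUV
    rw [parityMoment_parityVec hg hle, parityMoment_parityVec hg hy, parityMoment_parityVec hg hz,
      dotProduct_add, signChar_add]

theorem hammingNorm_exponentParity_le (μ : ι →₀ ℕ) :
    hammingNorm (exponentParity μ) ≤ μ.sum fun _ e => e := by
  rw [hammingNorm, Finset.card_filter, Finsupp.sum_fintype _ _ fun _ => rfl]
  refine Finset.sum_le_sum fun i _ => ?_
  split_ifs with h
  · refine Nat.one_le_iff_ne_zero.2 fun h0 => h ?_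
    rw [exponentParity_apply, h0, Nat.cast_zero]
  · exact Nat.zero_le _

/-- The linear functional on polynomials whose moments are given by `parityMoment`. -/
noncomputable def parityFunctional (g : κ → Fin 3 → ι) (b : κ → ZMod 2) (s : ℕ) :
    MvPolynomial ι ℝ →ₗ[ℝ] ℝ :=
  (basisMonomials ι ℝ).constr ℝ fun μ => parityMoment g b s (exponentParity μ)

theorem parityFunctional_monomial (μ : ι →₀ ℕ) (a : ℝ) :
    parityFunctional g b s (monomial μ a) = a * parityMoment g b s (exponentParity μ) := by
  have h := (basisMonomials ι ℝ).constr_basis ℝ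
    (fun μ => parityMoment g b s (exponentParity μ)) μ
  rw [coe_basisMonomials] at h
  rw [← mul_one a, ← smul_eq_mul, ← smul_monomial, map_smul, parityFunctional, h]
  simp

theorem parityMoment_zero (hg : IsParityExpanding g (2 * s)) : parityMoment g b s 0 = 1 := by
  have h := parityMoment_parityVec (b := b) hg (y := 0) (by simp)
  rwa [map_zero, dotProduct_zero, signChar_zero] at h

theorem parityFunctional_one (hg : IsParityExpanding g (2 * s)) :
    parityFunctional g b s 1 = 1 := by
  rw [← C_1, ← monomial_zero', parityFunctional_monomial, map_zero, parityMoment_zero hg, mul_one]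

theorem parityFunctional_X_sq_sub_one_mul (i : ι) (q : MvPolynomial ι ℝ) :
    parityFunctional g b s ((X i ^ 2 - 1) * q) = 0 := by
  induction q using MvPolynomial.induction_on' with
  | monomial μ a =>
    have h : exponentParity (Finsupp.single i 2) = 0 := by
      ext j
      rw [exponentParity_apply, Finsupp.single_apply]
      split_ifs <;> rfl
    rw [sub_mul, one_mul, X_pow_eq_monomial, monomial_mul, one_mul, map_sub,
      parityFunctional_monomial, parityFunctional_monomial, map_add, h, zero_add, sub_self]
  | add p q hp hq => rw [mul_add, map_add, hp, hq, add_zero]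

theorem parityFunctional_sq_nonneg (hg : IsParityExpanding g (2 * (2 * d)))
    {p : MvPolynomial ι ℝ} (hp : p.totalDegree ≤ d / 2) :
    0 ≤ parityFunctional g b (2 * d) (p ^ 2) := by
  have hexp : parityFunctional g b (2 * d) (p ^ 2) = ∑ μ ∈ p.support, ∑ ν ∈ p.support,
      p.coeff μ * p.coeff ν *
        parityMoment g b (2 * d) (exponentParity μ + exponentParity ν) := by
    conv_lhs => rw [p.as_sum, sq, Finset.sum_mul_sum]
    simp only [map_sum, monomial_mul, parityFunctional_monomial, map_add]
  have hdeg {μ : ι →₀ ℕ} (hμ : μ ∈ p.support) : hammingNorm (exponentParity μ) ≤ d / 2 :=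
    (hammingNorm_exponentParity_le μ).trans ((le_totalDegree hμ).trans hp)
  have hdeg_add {μ ν : ι →₀ ℕ} (hμ : μ ∈ p.support) (hν : ν ∈ p.support) :
      hammingNorm (exponentParity μ + exponentParity ν) ≤ d := by
    have h := hammingNorm_add_le_add (x := exponentParity μ) (y := exponentParity ν)
    have := hdeg hμ
    have := hdeg hν
    omega
  rw [hexp]
  refine sum_mul_kernel_nonneg p.support
    (fun μ ν => parityMoment g b (2 * d) (exponentParity μ + exponentParity ν)) _
    (fun μ ν => by rw [add_comm]) (fun μ => ?_) fun μ hμ ν hν ρ hρ hne => ?_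
  · rw [ZModModule.add_self, parityMoment_zero hg]
  · have h : exponentParity μ + exponentParity ρ =
        (exponentParity μ + exponentParity ν) + (exponentParity ν + exponentParity ρ) := by
      rw [add_assoc, ← add_assoc (exponentParity ν), ZModModule.add_self, zero_add]
    rw [h]
    exact parityMoment_add hg hne (hdeg_add hν hρ) (h ▸ hdeg_add hμ hρ)

end PseudoExpectation

section XorInstance

variable {m n : ℕ}

/-- The 3XOR instance whose clause `r` says that the variables `g r 0`, `g r 1`, `g r 2` have
product `signChar (b r)`. -/
noncomputable def xorInstance (g : Fin m → Fin 3 → Fin n) (b : Fin m → ZMod 2) :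
    List (XorClause n) :=
  List.ofFn fun r => ⟨g r 0, g r 1, g r 2, decide (b r = 0)⟩

theorem valPoly_xorInstance (g : Fin m → Fin 3 → Fin n) (b : Fin m → ZMod 2) :
    valPoly (xorInstance g b) = C (1 / (m : ℝ)) * ∑ r, C (1 / 2) *
      (1 + C (signChar (b r)) * (X (g r 0) * X (g r 1) * X (g r 2))) := by
  simp [valPoly, xorInstance, xorClausePoly, signChar, List.map_ofFn, List.sum_ofFn]

theorem eval_valPoly_xorInstance_le (g : Fin m → Fin 3 → Fin n) (b : Fin m → ZMod 2)
    (hm : 0 < m) {D : ℕ}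
    (hD : ∀ u : Fin n → ZMod 2, D ≤ hammingDist b fun r => u (g r 0) + u (g r 1) + u (g r 2))
    (x : Fin n → ℝ) (hx : IsPM x) : eval x (valPoly (xorInstance g b)) ≤ 1 - D / m := by
  let u : Fin n → ZMod 2 := fun i => if x i = 1 then 0 else 1
  have hu (i : Fin n) : x i = signChar (u i) := by
    rcases hx i with h | h
    · simp [u, h]
    · norm_num [u, h]
  have hm' : (0 : ℝ) < m := by exact_mod_cast hm
  rw [valPoly_xorInstance]
  simp only [map_mul, map_sum, map_add, map_one, eval_C, eval_X, hu]
  simp only [← signChar_add (u _), ← signChar_add (u _ + u _), half_one_add_signChar_mul]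
  rw [Finset.sum_sub_distrib, Finset.sum_boole, Finset.sum_const, Finset.card_univ,
    Fintype.card_fin, nsmul_eq_mul, mul_one, one_div_mul_eq_div, sub_div, div_self hm'.ne']
  gcongr
  exact hD u

theorem parityVec_single (g : Fin m → Fin 3 → Fin n) (r : Fin m) :
    parityVec g (Pi.single r 1) = exponentParity
      (Finsupp.single (g r 0) 1 + Finsupp.single (g r 1) 1 + Finsupp.single (g r 2) 1) := by
  ext i
  have h (p : Fin m) (l : Fin 3) :
      (if g p l = i then (Pi.single r 1 : Fin m → ZMod 2) p else 0) =
        if p = r then if g r l = i then 1 else 0 else 0 := by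
    by_cases hp : p = r
    · subst hp
      simp
    · simp [hp]
  simp [parityVec, exponentParity_apply, Fintype.sum_prod_type, h, Finset.sum_add_distrib,
    Fin.sum_univ_three, Finsupp.single_apply]

theorem parityFunctional_valPoly {g : Fin m → Fin 3 → Fin n} {b : Fin m → ZMod 2} {s : ℕ}
    (hm : 0 < m) (hs : 1 ≤ s) (hg : IsParityExpanding g (2 * s)) :
    parityFunctional g b s (valPoly (xorInstance g b)) = 1 := by
  have hm' : (m : ℝ) ≠ 0 := by positivity
  have hclause (r : Fin m) :
      parityFunctional g b s (X (g r 0) * X (g r 1) * X (g r 2)) = signChar (b r) := by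
    have hr : hammingNorm (Pi.single r 1 : Fin m → ZMod 2) ≤ s := by
      refine le_trans (Finset.card_le_one.2 fun i hi j hj => ?_) hs
      simp only [Finset.mem_filter, Finset.mem_univ, true_and, Pi.single_apply] at hi hj
      aesop
    rw [X, X, X, monomial_mul, monomial_mul, parityFunctional_monomial, ← parityVec_single,
      parityMoment_parityVec hg hr]
    simp
  rw [valPoly_xorInstance]
  simp only [C_mul', map_smul, map_sum, map_add, parityFunctional_one hg, hclause, smul_eq_mul,
    signChar_mul_self]
  norm_num [hm']

end XorInstance

/-- integrality gap for the honest classical value of the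
oracularized 3XOR game. -/
theorem honest_classical_game_integrality_gap :
    ∃ (c δ : ℝ) (n₀ : ℕ), 0 < c ∧ 0 < δ ∧
      ∀ n : ℕ, n₀ ≤ n →
        ∃ (Ψ : List (XorClause n)) (α β : ℝ),
          0 ≤ α ∧ 0 ≤ β ∧ α + β = 1 ∧ δ * 2 ≤ α ∧
          (∀ x : Fin n → ℝ, IsPM x →
            eval x (C α * valPoly Ψ + C β) ≤ 1 - δ) ∧
          ∃ E : MvPolynomial (Fin n) ℝ →ₗ[ℝ] ℝ,
            E 1 = 1 ∧
            (∀ p : MvPolynomial (Fin n) ℝ,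
              p.totalDegree ≤ ⌈c * n⌉₊ / 2 → 0 ≤ E (p ^ 2)) ∧
            (∀ (i : Fin n) (q : MvPolynomial (Fin n) ℝ),
              q.totalDegree ≤ ⌈c * n⌉₊ - 2 → E ((X i ^ 2 - 1) * q) = 0) ∧
            E (C α * valPoly Ψ + C β) = 1 := by
  refine ⟨1 / (8 * expansionRate), 1 / 8, 8 * expansionRate, by positivity, by norm_num,
    fun n hn => ?_⟩
  have hn0 : 0 < n := lt_of_lt_of_le (by positivity) hn
  set d : ℕ := ⌈1 / (8 * (expansionRate : ℝ)) * n⌉₊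
  have hd1 : 1 ≤ d := Nat.ceil_pos.2 (by positivity)
  have hdn : 2 * (2 * d) * expansionRate ≤ n := by
    have h1 : (d : ℝ) < 1 / (8 * (expansionRate : ℝ)) * n + 1 := Nat.ceil_lt_add_one (by positivity)
    have h2 : (8 * expansionRate : ℝ) ≤ n := by exact_mod_cast hn
    have h3 : (d : ℝ) * (8 * expansionRate) < n + 8 * expansionRate := by
      calc (d : ℝ) * (8 * expansionRate)
          < (1 / (8 * (expansionRate : ℝ)) * n + 1) * (8 * expansionRate) := by gcongr
        _ = n + 8 * expansionRate := by field_simp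
    have h4 : (2 * (2 * d) * expansionRate : ℝ) ≤ n := by linarith
    exact_mod_cast h4
  obtain ⟨g, hg⟩ := exists_expanding hn0 hdn
  have hg' : IsParityExpanding g (2 * (2 * d)) := fun y hy hyK =>
    lt_hammingNorm_parityVec g y <| by
      convert hg _ (Finset.card_pos.1 (hammingNorm_pos_iff.2 hy)) hyK
      rfl
  obtain ⟨b, hb⟩ := exists_forall_lt_hammingDist hn0 (Fintype.card_fin n)
    (Fintype.card_fin (8 * n)) fun u r => u (g r 0) + u (g r 1) + u (g r 2)
  refine ⟨xorInstance g b, 1, 0, by norm_num, le_rfl, by norm_num, by norm_num, fun x hx => ?_,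
    parityFunctional g b (2 * d), parityFunctional_one hg', fun p hp =>
      parityFunctional_sq_nonneg hg' hp, fun i q _ => parityFunctional_X_sq_sub_one_mul i q, ?_⟩
  · rw [C_1, C_0, one_mul, add_zero]
    refine (eval_valPoly_xorInstance_le g b (by omega) (fun u => (hb u).le) x hx).trans_eq ?_
    have : (n : ℝ) ≠ 0 := by positivity
    push_cast
    field_simp
  · rw [C_1, C_0, one_mul, add_zero]
    exact parityFunctional_valPoly (by omega) (by omega) hg'
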